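/- arXiv:1105.1574 — 2 statements merged into one kernel-verified Lean document; each statement's English description precedes it below -/
import Mathlib

section
/- Let n be a positive integer and f : 𝕊ₙ → ℝ a Frechet differentiable function. Define V(X,Y) := f(X Y⁻¹ Xᵀ) for X ∈ ℝ^{n×n} and invertible Y ∈ 𝕊ₙ. Then V satisfies the partial differential equation M(V) = 0 at every such (X,Y), i.e., (1/2) Xᵀ ∂_X V + Y ∂_Y V = 0, where ∂_X V and ∂_Y V are the partial Frobenius gradients of V. -/
open Matrix

attribute [local instance] Matrix.frobeniusNormedAddCommGroup Matrix.frobeniusNormedSpace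

/-- The subspace `𝕊ₙ` of real symmetric `n × n` matrices. -/
def symMat (n : ℕ) : Submodule ℝ (Matrix (Fin n) (Fin n) ℝ) where
  carrier := {Y | Yᵀ = Y}
  add_mem' := by
    intro a b ha hb
    simp only [Set.mem_setOf_eq] at *
    rw [Matrix.transpose_add, ha, hb]
  zero_mem' := by simp
  smul_mem' := by
    intro c a ha
    simp only [Set.mem_setOf_eq] at *
    rw [Matrix.transpose_smul, ha]

lemma mem_symMat {n : ℕ} {A : Matrix (Fin n) (Fin n) ℝ} : A ∈ symMat n ↔ Aᵀ = A :=
  Iff.rfl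

/-- The Frobenius inner product `⟨A, B⟩ = tr(Aᵀ B)`. -/
noncomputable def frob {n : ℕ} (A B : Matrix (Fin n) (Fin n) ℝ) : ℝ :=
  (Aᵀ * B).trace

/-- The map `W(X,Y) := X Y⁻¹ Xᵀ`, landing in symmetric matrices. -/
noncomputable def Wmap (n : ℕ) (p : Matrix (Fin n) (Fin n) ℝ × symMat n) : symMat n :=
  ⟨p.1 * (p.2 : Matrix (Fin n) (Fin n) ℝ)⁻¹ * p.1ᵀ, by
    have h : (p.2 : Matrix (Fin n) (Fin n) ℝ)ᵀ = (p.2 : Matrix (Fin n) (Fin n) ℝ) := p.2.2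
    rw [mem_symMat]
    rw [Matrix.transpose_mul, Matrix.transpose_mul, Matrix.transpose_transpose,
      Matrix.transpose_nonsing_inv, h, Matrix.mul_assoc]⟩

/-- The map `(X, Y) ↦ X Y⁻¹ Xᵀ` is invariant under `(X, Y) ↦ (X A, Aᵀ Y A)` for invertible `A`. -/
lemma Wmap_congr_of_isUnit {n : ℕ} {A X : Matrix (Fin n) (Fin n) ℝ} (hA : IsUnit A.det)
    {Y Z : symMat n}
    (hZ : (Z : Matrix (Fin n) (Fin n) ℝ) = Aᵀ * Y * A) :
    Wmap n (X * A, Z) = Wmap n (X, Y) := by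
  apply Subtype.ext
  have hA' : IsUnit Aᵀ.det := by rwa [Matrix.det_transpose]
  simp only [Wmap, hZ, Matrix.mul_inv_rev, Matrix.transpose_mul]
  simp only [Matrix.mul_assoc]
  rw [Matrix.nonsing_inv_mul_cancel_left _ _ hA', Matrix.mul_nonsing_inv_cancel_left _ _ hA]

lemma eventually_isUnit_det_one_add_smul {n : ℕ} (B : Matrix (Fin n) (Fin n) ℝ) :
    ∀ᶠ t : ℝ in nhds 0, IsUnit (1 + t • B).det := by
  have hc : Continuous fun t : ℝ => (1 + t • B).det := by
    apply Continuous.matrix_det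
    fun_prop
  simpa only [isUnit_iff_ne_zero] using hc.continuousAt.eventually_ne (by simp)

/-- The derivative of a function of `X Y⁻¹ Xᵀ` vanishes in the directions `(X B, Bᵀ Y + Y B)`
tangent to the orbits of the congruence action. -/
lemma fderiv_comp_Wmap_apply_eq_zero {n : ℕ} {f : symMat n → ℝ}
    {X B : Matrix (Fin n) (Fin n) ℝ} {Y D : symMat n}
    {L : (Matrix (Fin n) (Fin n) ℝ × symMat n) →L[ℝ] ℝ}
    (hd : HasFDerivAt (fun p : Matrix (Fin n) (Fin n) ℝ × symMat n => f (Wmap n p)) L (X, Y))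
    (hD : (D : Matrix (Fin n) (Fin n) ℝ) = Bᵀ * Y + Y * B) :
    L (X * B, D) = 0 := by
  have hY : (Y : Matrix (Fin n) (Fin n) ℝ)ᵀ = Y := Y.2
  let E : symMat n := ⟨Bᵀ * Y * B, by
    rw [mem_symMat, Matrix.transpose_mul, Matrix.transpose_mul, Matrix.transpose_transpose, hY,
      Matrix.mul_assoc]⟩
  have h₁ : HasDerivAt (fun t : ℝ => X + t • (X * B)) (X * B) 0 := by
    exact (((hasDerivAt_id (0 : ℝ)).smul_const (X * B)).const_add X).congr_deriv (one_smul ℝ _)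
  have h₂ : HasDerivAt (fun t : ℝ => Y + t • D + t ^ 2 • E) D 0 := by
    exact ((((hasDerivAt_id (0 : ℝ)).smul_const D).const_add Y).add
      (((hasDerivAt_id (0 : ℝ)).pow 2).smul_const E)).congr_deriv (by simp)
  have hcomp := hd.comp_hasDerivAt_of_eq 0 (h₁.prodMk h₂) (by simp)
  refine hcomp.unique ((hasDerivAt_const (0 : ℝ) (f (Wmap n (X, Y)))).congr_of_eventuallyEq ?_)
  filter_upwards [eventually_isUnit_det_one_add_smul B] with t ht
  have hX : X + t • (X * B) = X * (1 + t • B) := by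
    rw [Matrix.mul_add, Matrix.mul_one, Matrix.mul_smul]
  simp only [Function.comp_apply, hX]
  rw [Wmap_congr_of_isUnit ht (Y := Y)]
  simp only [E, Submodule.coe_add, Submodule.coe_smul, hD, Matrix.transpose_add,
    Matrix.transpose_one, Matrix.transpose_smul, Matrix.add_mul, Matrix.mul_add, Matrix.one_mul,
    Matrix.mul_one, Matrix.smul_mul, Matrix.mul_smul, smul_add, smul_smul, pow_two]
  abel

theorem stmt_8 (n : ℕ) (hn : 0 < n)
    (f : symMat n → ℝ) (hf : Differentiable ℝ f)
    (X : Matrix (Fin n) (Fin n) ℝ) (Y : symMat n)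
    (hY : IsUnit (Y : Matrix (Fin n) (Fin n) ℝ))
    -- Frobenius gradient data (∂_X V, ∂_Y V) of V(X,Y) := f(X Y⁻¹ Xᵀ) at (X, Y)
    (gX : Matrix (Fin n) (Fin n) ℝ) (gY : symMat n)
    (L : (Matrix (Fin n) (Fin n) ℝ × symMat n) →L[ℝ] ℝ)
    (hd : HasFDerivAt (fun p : Matrix (Fin n) (Fin n) ℝ × symMat n => f (Wmap n p)) L (X, Y))
    (hrep : ∀ δ : Matrix (Fin n) (Fin n) ℝ × symMat n,
      L δ = frob gX δ.1 + frob (gY : Matrix (Fin n) (Fin n) ℝ) (δ.2 : Matrix (Fin n) (Fin n) ℝ)) :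
    -- the PDE M(V) = 0
    (1 / 2 : ℝ) • (Xᵀ * gX) + (Y : Matrix (Fin n) (Fin n) ℝ) * (gY : Matrix (Fin n) (Fin n) ℝ) = 0 := by
  have hYs : (Y : Matrix (Fin n) (Fin n) ℝ)ᵀ = Y := Y.2
  have hgs : (gY : Matrix (Fin n) (Fin n) ℝ)ᵀ = gY := gY.2
  have horth (B : Matrix (Fin n) (Fin n) ℝ) :
      ((gXᵀ * X + (2 : ℝ) • ((gY : Matrix (Fin n) (Fin n) ℝ) * Y)) * B).trace = 0 := by
    let D : symMat n := ⟨Bᵀ * Y + Y * B, by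
      rw [mem_symMat, Matrix.transpose_add, Matrix.transpose_mul, Matrix.transpose_mul,
        Matrix.transpose_transpose, hYs, add_comm]⟩
    have h := fderiv_comp_Wmap_apply_eq_zero hd (D := D) rfl
    have hflip : ((gY : Matrix (Fin n) (Fin n) ℝ) * (Bᵀ * Y)).trace
        = ((gY : Matrix (Fin n) (Fin n) ℝ) * (Y * B)).trace := by
      rw [← Matrix.trace_transpose, Matrix.transpose_mul, Matrix.transpose_mul,
        Matrix.transpose_transpose, hYs, hgs, Matrix.trace_mul_comm]
    rw [hrep] at h
    simp only [frob, D, hgs, Matrix.mul_add, Matrix.trace_add, hflip] at h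
    simp only [Matrix.add_mul, Matrix.smul_mul, Matrix.trace_add, Matrix.trace_smul,
      Matrix.mul_assoc, smul_eq_mul]
    linarith
  have hzero : gXᵀ * X + (2 : ℝ) • ((gY : Matrix (Fin n) (Fin n) ℝ) * Y) = 0 :=
    Matrix.ext_iff_trace_mul_right.mpr fun B => by simpa using horth B
  have hT := congrArg (fun M => (1 / 2 : ℝ) • Mᵀ) hzero
  simpa [Matrix.transpose_mul, hYs, hgs, smul_smul] using hT
end

section
/- Let n be a positive integer and V : ℝ^{n×n} × 𝕊ₙ → ℝ a Frechet differentiable function satisfying M(V) = 0 (i.e., (1/2) Xᵀ ∂_X V + Y ∂_Y V = 0) at every (X,Y) with X and Y invertible. Let [0,1] ∋ s ↦ (X(s), Y(s)) be a continuously differentiable curve such that X(s) and Y(s) ∈ 𝕊ₙ are invertible for all s and X(s) Y(s)⁻¹ X(s)ᵀ is constant in s. Then the function s ↦ V(X(s), Y(s)) has zero derivative on [0,1], hence is constant. -/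
open Matrix

attribute [local instance] Matrix.frobeniusNormedAddCommGroup Matrix.frobeniusNormedSpace

/-- The product rule for matrix-valued curves, in the Frobenius norm. -/
theorem hasDerivWithinAt_matrix_mul {n : ℕ} {A B : ℝ → Matrix (Fin n) (Fin n) ℝ}
    {A' B' : Matrix (Fin n) (Fin n) ℝ} {S : Set ℝ} {s : ℝ}
    (hA : HasDerivWithinAt A A' S s) (hB : HasDerivWithinAt B B' S s) :
    HasDerivWithinAt (fun t => A t * B t) (A' * B s + A s * B') S s := by
  let _ : NormedRing (Matrix (Fin n) (Fin n) ℝ) := Matrix.frobeniusNormedRing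
  let _ : NormedAlgebra ℝ (Matrix (Fin n) (Fin n) ℝ) := Matrix.frobeniusNormedAlgebra
  exact HasDerivWithinAt.mul hA hB

/-- Transposition commutes with differentiation of matrix-valued curves. -/
theorem hasDerivWithinAt_matrix_transpose {n : ℕ} {A : ℝ → Matrix (Fin n) (Fin n) ℝ}
    {A' : Matrix (Fin n) (Fin n) ℝ} {S : Set ℝ} {s : ℝ} (hA : HasDerivWithinAt A A' S s) :
    HasDerivWithinAt (fun t => (A t)ᵀ) A'ᵀ S s :=
  (Matrix.transposeLinearEquiv (Fin n) (Fin n) ℝ ℝ).toLinearMap.toContinuousLinearMap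
    |>.hasFDerivAt.comp_hasDerivWithinAt s hA

/-- If `X Y⁻¹ Xᵀ = C` with `X`, `Y` invertible then `Y = Xᵀ C⁻¹ X`. -/
theorem eq_transpose_mul_inv_mul {n : ℕ} {X Y C : Matrix (Fin n) (Fin n) ℝ}
    (hX : IsUnit X) (hY : IsUnit Y) (h : X * Y⁻¹ * Xᵀ = C) : Y = Xᵀ * C⁻¹ * X := by
  have hXd := (Matrix.isUnit_iff_isUnit_det X).1 hX
  have hYd := (Matrix.isUnit_iff_isUnit_det Y).1 hY
  have hXt : IsUnit (Xᵀ).det := by rwa [Matrix.det_transpose]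
  rw [← h, Matrix.mul_inv_rev, Matrix.mul_inv_rev, Matrix.nonsing_inv_nonsing_inv Y hYd,
    ← Matrix.mul_assoc, Matrix.mul_nonsing_inv Xᵀ hXt, Matrix.one_mul, Matrix.mul_assoc,
    Matrix.nonsing_inv_mul X hXd, Matrix.mul_one]

/-- A gradient `(G, H)` satisfying `(1/2) Xᵀ G + Y H = 0` is orthogonal to every velocity tangent
to the constraint `Y = Xᵀ D X`. -/
theorem frob_add_frob_eq_zero {n : ℕ} {X X' D G H : Matrix (Fin n) (Fin n) ℝ}
    (hX : IsUnit X) (hD : Dᵀ = D) (hH : Hᵀ = H)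
    (h : (1 / 2 : ℝ) • (Xᵀ * G) + Xᵀ * D * X * H = 0) :
    frob G X' + frob H (X'ᵀ * (D * X) + Xᵀ * (D * X')) = 0 := by
  have hXt : IsUnit Xᵀ := by
    rwa [Matrix.isUnit_iff_isUnit_det, Matrix.det_transpose, ← Matrix.isUnit_iff_isUnit_det]
  have hG : G = (-2 : ℝ) • (D * X * H) := by
    have h0 : Xᵀ * ((1 / 2 : ℝ) • G + D * X * H) = Xᵀ * 0 := by
      rw [Matrix.mul_zero, ← h, Matrix.mul_add, Matrix.mul_smul]
      simp only [Matrix.mul_assoc]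
    have h1 := hXt.mul_left_cancel h0
    have h2 := congrArg (fun M => (2 : ℝ) • M) (eq_neg_of_add_eq_zero_left h1)
    simpa [smul_smul] using h2
  have key : (H * (X'ᵀ * (D * X))).trace = (H * (Xᵀ * (D * X'))).trace := by
    rw [← Matrix.trace_transpose]
    simp only [Matrix.transpose_mul, Matrix.transpose_transpose, hD, hH]
    rw [Matrix.trace_mul_comm]
    simp only [Matrix.mul_assoc]
  subst hG
  simp only [frob, Matrix.transpose_smul, Matrix.transpose_mul, hD, hH, Matrix.smul_mul,
    Matrix.trace_smul, Matrix.mul_add, Matrix.trace_add, key, Matrix.mul_assoc, smul_eq_mul]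
  ring

theorem stmt_9 (n : ℕ) (hn : 0 < n)
    (V : Matrix (Fin n) (Fin n) ℝ × symMat n → ℝ)
    -- Frobenius gradient data (∂_X V, ∂_Y V) for V at points with X and Y invertible
    (gX : Matrix (Fin n) (Fin n) ℝ × symMat n → Matrix (Fin n) (Fin n) ℝ)
    (gY : Matrix (Fin n) (Fin n) ℝ × symMat n → symMat n)
    (Lfun : Matrix (Fin n) (Fin n) ℝ × symMat n →
        (Matrix (Fin n) (Fin n) ℝ × symMat n) →L[ℝ] ℝ)
    (hdiff : ∀ p : Matrix (Fin n) (Fin n) ℝ × symMat n,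
      IsUnit p.1 → IsUnit (p.2 : Matrix (Fin n) (Fin n) ℝ) → HasFDerivAt V (Lfun p) p)
    (hrep : ∀ p δ, Lfun p δ = frob (gX p) δ.1 +
      frob (gY p : Matrix (Fin n) (Fin n) ℝ) (δ.2 : Matrix (Fin n) (Fin n) ℝ))
    -- V satisfies the PDE M(V) = 0 at every invertible point
    (hPDE : ∀ p : Matrix (Fin n) (Fin n) ℝ × symMat n,
      IsUnit p.1 → IsUnit (p.2 : Matrix (Fin n) (Fin n) ℝ) →
      (1 / 2 : ℝ) • (p.1ᵀ * gX p) +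
        (p.2 : Matrix (Fin n) (Fin n) ℝ) * (gY p : Matrix (Fin n) (Fin n) ℝ) = 0)
    -- a continuously differentiable curve on [0,1]
    (X : ℝ → Matrix (Fin n) (Fin n) ℝ) (Y : ℝ → symMat n)
    (hC1 : ContDiffOn ℝ 1 (fun s => (X s, Y s)) (Set.Icc 0 1))
    (hXinv : ∀ s ∈ Set.Icc (0 : ℝ) 1, IsUnit (X s))
    (hYinv : ∀ s ∈ Set.Icc (0 : ℝ) 1, IsUnit ((Y s : Matrix (Fin n) (Fin n) ℝ)))
    -- X(s) Y(s)⁻¹ X(s)ᵀ is constant in s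
    (hconst : ∀ s ∈ Set.Icc (0 : ℝ) 1,
      X s * (Y s : Matrix (Fin n) (Fin n) ℝ)⁻¹ * (X s)ᵀ =
      X 0 * (Y 0 : Matrix (Fin n) (Fin n) ℝ)⁻¹ * (X 0)ᵀ) :
    -- s ↦ V(X(s), Y(s)) has zero derivative on [0,1], hence is constant
    (∀ s ∈ Set.Icc (0 : ℝ) 1,
      derivWithin (fun s => V (X s, Y s)) (Set.Icc 0 1) s = 0) ∧
    (∀ s ∈ Set.Icc (0 : ℝ) 1, V (X s, Y s) = V (X 0, Y 0)) := by
  set C := X 0 * (Y 0 : Matrix (Fin n) (Fin n) ℝ)⁻¹ * (X 0)ᵀ with hC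
  have hY : ∀ s ∈ Set.Icc (0 : ℝ) 1,
      (Y s : Matrix (Fin n) (Fin n) ℝ) = (X s)ᵀ * (C⁻¹ * X s) := fun s hs => by
    rw [← Matrix.mul_assoc]
    exact eq_transpose_mul_inv_mul (hXinv s hs) (hYinv s hs) (hconst s hs)
  have hCsymm : (C⁻¹)ᵀ = C⁻¹ := by
    rw [Matrix.transpose_nonsing_inv, hC]
    simp only [Matrix.transpose_mul, Matrix.transpose_transpose, Matrix.transpose_nonsing_inv,
      show ((Y 0 : Matrix (Fin n) (Fin n) ℝ))ᵀ = Y 0 from (Y 0).2, Matrix.mul_assoc]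
  have hderiv : ∀ s ∈ Set.Icc (0 : ℝ) 1,
      HasDerivWithinAt (fun s => V (X s, Y s)) 0 (Set.Icc 0 1) s := by
    intro s hs
    have hXY := (hC1.differentiableOn one_ne_zero s hs).hasDerivWithinAt
    set v := derivWithin (fun s => (X s, Y s)) (Set.Icc 0 1) s
    have hX' : HasDerivWithinAt X v.1 (Set.Icc 0 1) s :=
      (ContinuousLinearMap.fst ℝ (Matrix (Fin n) (Fin n) ℝ) (symMat n)).hasFDerivAt
        |>.comp_hasDerivWithinAt s hXY
    have hY' : HasDerivWithinAt (fun t => (Y t : Matrix (Fin n) (Fin n) ℝ)) v.2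
        (Set.Icc 0 1) s :=
      ((symMat n).subtypeL.comp
        (ContinuousLinearMap.snd ℝ (Matrix (Fin n) (Fin n) ℝ) (symMat n))).hasFDerivAt
        |>.comp_hasDerivWithinAt s hXY
    have hprod := (hasDerivWithinAt_matrix_mul (hasDerivWithinAt_matrix_transpose hX')
      (hasDerivWithinAt_matrix_mul (hasDerivWithinAt_const s _ C⁻¹) hX')).congr hY (hY s hs)
    have hv := (uniqueDiffOn_Icc_zero_one s hs).eq_deriv _ hY' hprod
    rw [Matrix.zero_mul, zero_add] at hv
    have hVd := (hdiff (X s, Y s) (hXinv s hs) (hYinv s hs)).comp_hasDerivWithinAt s hXY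
    have hpde := hPDE (X s, Y s) (hXinv s hs) (hYinv s hs)
    simp only [hY s hs, ← Matrix.mul_assoc (X s)ᵀ] at hpde
    have hLv : Lfun (X s, Y s) v = 0 := by
      rw [hrep, hv, frob_add_frob_eq_zero (hXinv s hs) hCsymm (gY (X s, Y s)).2 hpde]
    exact hVd.congr_deriv hLv
  refine ⟨fun s hs => (hderiv s hs).derivWithin (uniqueDiffOn_Icc_zero_one s hs),
    fun s hs => ?_⟩
  exact constant_of_has_deriv_right_zero (fun t ht => (hderiv t ht).continuousWithinAt)
    (fun t ht => (hderiv t (Set.Ico_subset_Icc_self ht)).mono_of_mem_nhdsWithin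
      (Icc_mem_nhdsGE_of_mem ht)) s hs
end
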